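/- Let R be a standard graded reduced ring of dimension 1 over a perfect field of characteristic p > 0, and I a homogeneous ideal of finite colength. With f_n(x) = ℓ(R/I^{[p^n]})_{⌊x p^n⌋} and f(x) = lim_n f_n(x), one has e_HK(R, I) = ∫_ℝ f(x) dx, and moreover |∫_ℝ f_n − ∫_ℝ f| ≤ L·(μ+1)·m_0/p^n where L = max{ℓ(R_0),…,ℓ(R_{m_0})}. -/

import Mathlib

open Filter Topology MeasureTheory

/-- The `q`-th Frobenius power `I^{[q]}` of an ideal. -/
def frobeniusPower {R : Type*} [CommRing R] (I : Ideal R) (q : ℕ) : Ideal R :=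
  Ideal.span ((fun x => x ^ q) '' (I : Set R))

/-- `ℓ(R/I^{[q]})_m`: the `k`-dimension of the degree-`m` graded piece of `R/I^{[q]}`. -/
noncomputable def ringGradedPieceLength {k R : Type*} [Field k] [CommRing R] [Algebra k R]
    (𝒜 : ℕ → Submodule k R) (I : Ideal R) (q m : ℕ) : ℕ :=
  Module.finrank k ((𝒜 m).map (Ideal.Quotient.mkₐ k (frobeniusPower I q)).toLinearMap)

/-- The step function `f_n(x) = ℓ(R/I^{[p^n]})_{⌊x p^n⌋}` (and `0` for `x < 0`). -/
noncomputable def fDimOne {k R : Type*} [Field k] [CommRing R] [Algebra k R]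
    (𝒜 : ℕ → Submodule k R) (I : Ideal R) (p n : ℕ) (x : ℝ) : ℝ :=
  if x < 0 then 0
  else (ringGradedPieceLength 𝒜 I (p ^ n) (Nat.floor (x * (p : ℝ) ^ n)) : ℝ)

/-! ### Minimal primes and homogeneous nonzerodivisors -/

lemma Ideal.isHomogeneous_of_mem_minimalPrimes_bot {k R : Type*} [Field k] [CommRing R]
    [Algebra k R] (𝒜 : ℕ → Submodule k R) [GradedAlgebra 𝒜] {P : Ideal R}
    (hP : P ∈ (⊥ : Ideal R).minimalPrimes) : P.IsHomogeneous 𝒜 := by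
  have hcore : (P.homogeneousCore 𝒜).toIdeal.IsPrime := Ideal.IsPrime.homogeneousCore hP.1.1
  have hle := Ideal.toIdeal_homogeneousCore_le 𝒜 P
  have heq : (P.homogeneousCore 𝒜).toIdeal = P := le_antisymm hle (hP.2 ⟨hcore, bot_le⟩ hle)
  rw [← heq]
  exact (P.homogeneousCore 𝒜).isHomogeneous

lemma Ideal.exists_homogeneous_mem_notMem {k R : Type*} [Field k] [CommRing R]
    [Algebra k R] (𝒜 : ℕ → Submodule k R) [GradedAlgebra 𝒜] {P Q : Ideal R}
    (hQ : Q.IsHomogeneous 𝒜) (hQP : ¬ Q ≤ P) : ∃ d, ∃ a ∈ 𝒜 d, a ∈ Q ∧ a ∉ P := by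
  classical
  by_contra! h
  refine hQP fun x hx => ?_
  rw [← DirectSum.sum_support_decompose 𝒜 x]
  exact P.sum_mem fun i _ => h i _ (SetLike.coe_mem _) (hQ i hx)

lemma mem_of_degree_one_le {k R : Type*} [Field k] [CommRing R] [Algebra k R]
    (𝒜 : ℕ → Submodule k R)
    (hstd : ∀ m : ℕ, (𝒜 (m + 1) : Set R) ⊆
      Submodule.span k (Set.image2 (· * ·) (𝒜 1 : Set R) (𝒜 m : Set R))) (m : ℕ) :
    𝒜 m ≤ ((Ideal.span (𝒜 1 : Set R)) ^ m).restrictScalars k := by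
  induction m with
  | zero => simp
  | succ m ih =>
    intro x hx
    refine Submodule.span_le.2 ?_ (hstd m hx)
    rintro _ ⟨a, ha, b, hb, rfl⟩
    simp only [SetLike.mem_coe, Submodule.restrictScalars_mem, pow_succ']
    exact Ideal.mul_mem_mul (Ideal.subset_span ha) (ih hb)

/-- In a reduced Noetherian standard graded ring there are, in every large degree, elements
which are nonzerodivisors on the part of positive degree. -/
lemma exists_homogeneous_nonzerodivisor {k R : Type*} [Field k] [CommRing R]
    [IsNoetherianRing R] [Algebra k R] [IsReduced R] (𝒜 : ℕ → Submodule k R) [GradedAlgebra 𝒜]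
    (hstd : ∀ m : ℕ, (𝒜 (m + 1) : Set R) ⊆
      Submodule.span k (Set.image2 (· * ·) (𝒜 1 : Set R) (𝒜 m : Set R))) :
    ∃ D₀, ∀ D, D₀ ≤ D → ∃ y ∈ 𝒜 D, ∀ a, 1 ≤ a → ∀ z ∈ 𝒜 a, y * z = 0 → z = 0 := by
  classical
  have hfin := (⊥ : Ideal R).finite_minimalPrimes_of_isNoetherianRing
  set s : Finset (Ideal R) := hfin.toFinset.filter fun P => ∃ x ∈ 𝒜 1, x ∉ P with hs
  have hmin : ∀ P ∈ s, P ∈ (⊥ : Ideal R).minimalPrimes := fun P hP =>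
    hfin.mem_toFinset.1 (Finset.mem_filter.1 hP).1
  have hprime : ∀ P ∈ s, P.IsPrime := fun P hP => (hmin P hP).1.1
  have hsep : ∀ P Q : Ideal R, ∃ d, ∃ a ∈ 𝒜 d, P ∈ s → Q ∈ s → Q ≠ P → a ∈ Q ∧ a ∉ P := by
    intro P Q
    by_cases h : P ∈ s ∧ Q ∈ s ∧ Q ≠ P
    · obtain ⟨hP, hQ, hne⟩ := h
      have hle : ¬ Q ≤ P := fun hle =>
        hne (le_antisymm hle ((hmin P hP).2 (hmin Q hQ).1 hle))
      obtain ⟨d, a, ha, h1, h2⟩ := Ideal.exists_homogeneous_mem_notMem 𝒜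
        (Ideal.isHomogeneous_of_mem_minimalPrimes_bot 𝒜 (hmin Q hQ)) hle
      exact ⟨d, a, ha, fun _ _ _ => ⟨h1, h2⟩⟩
    · exact ⟨0, 0, zero_mem _, fun h1 h2 h3 => absurd ⟨h1, h2, h3⟩ h⟩
  choose d a had ha using hsep
  have hx : ∀ P : Ideal R, ∃ x ∈ 𝒜 1, P ∈ s → x ∉ P := by
    intro P
    by_cases hP : P ∈ s
    · obtain ⟨x, hx, hxP⟩ := (Finset.mem_filter.1 hP).2
      exact ⟨x, hx, fun _ => hxP⟩
    · exact ⟨0, zero_mem _, fun h => absurd h hP⟩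
  choose x hx1 hxP using hx
  refine ⟨s.sup fun P => ∑ Q ∈ s.erase P, d P Q, fun D hD => ?_⟩
  let e : Ideal R → R := fun P =>
    (∏ Q ∈ s.erase P, a P Q) * x P ^ (D - ∑ Q ∈ s.erase P, d P Q)
  have heQ : ∀ P ∈ s, ∀ Q ∈ s, Q ≠ P → e P ∈ Q := fun P hP Q hQ hne =>
    Q.mul_mem_right _ (Ideal.prod_mem Q (Finset.mem_erase.2 ⟨hne, hQ⟩) (ha P Q hP hQ hne).1)
  have heP : ∀ P ∈ s, e P ∉ P := by
    intro P hP hmem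
    have := hprime P hP
    rcases this.mem_or_mem hmem with h | h
    · obtain ⟨Q, hQ, h⟩ := this.prod_mem_iff.1 h
      obtain ⟨hne, hQ⟩ := Finset.mem_erase.1 hQ
      exact (ha P Q hP hQ hne).2 h
    · exact hxP P hP (this.mem_of_pow_mem _ h)
  refine ⟨∑ P ∈ s, e P, sum_mem fun P hP => ?_, fun b hb z hz hyz => ?_⟩
  · have hdeg : ∑ Q ∈ s.erase P, d P Q + (D - ∑ Q ∈ s.erase P, d P Q) • 1 = D := by
      have := (Finset.le_sup (f := fun P => ∑ Q ∈ s.erase P, d P Q) hP).trans hD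
      simp only [smul_eq_mul, mul_one]
      exact Nat.add_sub_cancel' this
    rw [← hdeg]
    convert SetLike.mul_mem_graded (SetLike.prod_mem_graded 𝒜 (d P) (a P) fun Q _ => had P Q)
      (SetLike.pow_mem_graded (D - ∑ Q ∈ s.erase P, d P Q) (hx1 P)) using 1
  · have hz0 : z ∈ sInf (⊥ : Ideal R).minimalPrimes := by
      rw [Submodule.mem_sInf]
      intro P hP
      by_cases hPs : P ∈ s
      · have hyP : ∑ P ∈ s, e P ∉ P := by
          rw [← Finset.add_sum_erase s e hPs]
          intro h
          refine heP P hPs ((Submodule.add_mem_iff_left P ?_).1 h)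
          refine P.sum_mem fun Q hQ => ?_
          obtain ⟨hne, hQ⟩ := Finset.mem_erase.1 hQ
          exact heQ Q hQ P hPs hne.symm
        exact (hP.1.1.mem_or_mem (hyz ▸ P.zero_mem)).resolve_left hyP
      · have h1 : ∀ x ∈ 𝒜 1, x ∈ P := by
          by_contra! h
          exact hPs (Finset.mem_filter.2 ⟨hfin.mem_toFinset.2 hP, h⟩)
        exact (Ideal.pow_le_self (by omega : b ≠ 0)).trans (Ideal.span_le.2 h1)
          (mem_of_degree_one_le 𝒜 hstd b hz)
    rw [Ideal.sInf_minimalPrimes] at hz0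
    obtain ⟨n, hn⟩ := hz0
    exact eq_zero_of_pow_eq_zero hn

/-! ### Dimensions of graded pieces -/

lemma Submodule.finrank_map_add_finrank_inf_ker {k V W : Type*} [Field k] [AddCommGroup V]
    [Module k V] [AddCommGroup W] [Module k W] (f : V →ₗ[k] W) (U : Submodule k V)
    [FiniteDimensional k U] :
    Module.finrank k (U.map f) + Module.finrank k (f.ker ⊓ U : Submodule k V) =
      Module.finrank k U := by
  rw [← LinearMap.finrank_range_add_finrank_ker (f.domRestrict U), LinearMap.range_domRestrict,
    LinearMap.ker_domRestrict]
  congr 1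
  rw [← Submodule.finrank_map_subtype_eq U, Submodule.map_comap_subtype, inf_comm]

lemma Submodule.finrank_map_of_forall_eq_zero {k V W : Type*} [Field k] [AddCommGroup V]
    [Module k V] [AddCommGroup W] [Module k W] (f : V →ₗ[k] W) (U : Submodule k V)
    [FiniteDimensional k U] (h : ∀ v ∈ U, f v = 0 → v = 0) :
    Module.finrank k (U.map f) = Module.finrank k U := by
  have hbot : (f.ker ⊓ U : Submodule k V) = ⊥ :=
    (Submodule.eq_bot_iff _).2 fun v hv => h v hv.2 hv.1
  have := Submodule.finrank_map_add_finrank_inf_ker f U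
  rwa [hbot, finrank_bot, add_zero] at this

lemma Nat.eq_of_forall_add_eq {h : ℕ → ℕ} {m₀ D₀ : ℕ}
    (H : ∀ a, m₀ ≤ a → ∀ D, D₀ ≤ D → h (a + D) = h a) {a b : ℕ} (ha : m₀ ≤ a) (hb : m₀ ≤ b) :
    h a = h b := by
  wlog hab : a ≤ b generalizing a b
  · exact (this hb ha (le_of_not_ge hab)).symm
  rw [← H a ha (D₀ + (b - a)) (by omega), ← H b hb D₀ le_rfl]
  congr 1
  omega

/-- The degree-`m` part of the ideal generated by the elements `g i`, `i ∈ S`, of degree `d i`,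
provided `d i ≤ m` for `i ∈ S`. -/
def gradedSpan {k R ι : Type*} [Field k] [CommRing R] [Algebra k R]
    (𝒜 : ℕ → Submodule k R) (g : ι → R) (d : ι → ℕ) (S : Finset ι) (m : ℕ) : Submodule k R :=
  ⨆ i ∈ S, (𝒜 (m - d i)).map (LinearMap.mulLeft k (g i))

lemma gradedSpan_le {k R ι : Type*} [Field k] [CommRing R] [Algebra k R]
    (𝒜 : ℕ → Submodule k R) [GradedAlgebra 𝒜] {g : ι → R} {d : ι → ℕ} (hg : ∀ i, g i ∈ 𝒜 (d i))
    {S : Finset ι} {m : ℕ} (hS : ∀ i ∈ S, d i ≤ m) : gradedSpan 𝒜 g d S m ≤ 𝒜 m := by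
  refine iSup₂_le fun i hi => ?_
  rintro _ ⟨z, hz, rfl⟩
  have := SetLike.mul_mem_graded (hg i) hz
  rwa [Nat.add_sub_cancel' (hS i hi)] at this

lemma span_range_inf_eq_gradedSpan {k R ι : Type*} [Fintype ι] [Field k] [CommRing R]
    [Algebra k R] (𝒜 : ℕ → Submodule k R) [GradedAlgebra 𝒜] {g : ι → R} {d : ι → ℕ}
    (hg : ∀ i, g i ∈ 𝒜 (d i)) (m : ℕ) :
    (Ideal.span (Set.range g)).restrictScalars k ⊓ 𝒜 m =
      gradedSpan 𝒜 g d (Finset.univ.filter fun i => d i ≤ m) m := by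
  classical
  refine le_antisymm ?_ (le_inf ?_ (gradedSpan_le 𝒜 hg fun i hi => (Finset.mem_filter.1 hi).2))
  · rintro x ⟨hx, hxm⟩
    obtain ⟨c, rfl⟩ := Ideal.mem_span_range_iff_exists_fun.1 hx
    have hproj := DirectSum.decompose_of_mem_same 𝒜 hxm
    rw [← hproj, DirectSum.decompose_sum, DFinsupp.finsetSum_apply, AddSubmonoidClass.coe_finsetSum]
    refine sum_mem fun i _ => ?_
    rw [DirectSum.coe_decompose_mul_of_right_mem 𝒜 m (hg i)]
    split_ifs with h
    · refine Submodule.mem_iSup_of_mem i (Submodule.mem_iSup_of_mem (by simpa using h) ?_)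
      exact ⟨_, SetLike.coe_mem _, mul_comm _ _⟩
    · exact zero_mem _
  · refine iSup₂_le fun i hi => ?_
    rintro _ ⟨z, hz, rfl⟩
    exact Ideal.mul_mem_right _ _ (Ideal.subset_span ⟨i, rfl⟩)

lemma map_mulLeft_eq {k R : Type*} [Field k] [CommRing R] [Algebra k R]
    (𝒜 : ℕ → Submodule k R) [GradedAlgebra 𝒜] [∀ m, FiniteDimensional k (𝒜 m)] {y : R} {a D : ℕ}
    (hy : y ∈ 𝒜 D) (hinj : ∀ z ∈ 𝒜 a, y * z = 0 → z = 0)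
    (hrank : Module.finrank k (𝒜 a) = Module.finrank k (𝒜 (a + D))) :
    (𝒜 a).map (LinearMap.mulLeft k y) = 𝒜 (a + D) := by
  refine Submodule.eq_of_le_of_finrank_eq ?_ ?_
  · rintro _ ⟨z, hz, rfl⟩
    rw [add_comm]
    exact SetLike.mul_mem_graded hy hz
  · rw [Submodule.finrank_map_of_forall_eq_zero _ _ hinj, hrank]

lemma finrank_gradedSpan_eq {k R : Type*} [Field k] [CommRing R] [IsNoetherianRing R]
    [Algebra k R] [IsReduced R]
    (𝒜 : ℕ → Submodule k R) [GradedAlgebra 𝒜] [∀ m, FiniteDimensional k (𝒜 m)]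
    (hstd : ∀ m : ℕ, (𝒜 (m + 1) : Set R) ⊆
      Submodule.span k (Set.image2 (· * ·) (𝒜 1 : Set R) (𝒜 m : Set R)))
    {m₀ : ℕ} (hm₀ : 1 ≤ m₀)
    (hstab : ∀ m, m₀ ≤ m → Module.finrank k (𝒜 m) = Module.finrank k (𝒜 m₀))
    {ι : Type*} {g : ι → R} {d : ι → ℕ} (hg : ∀ i, g i ∈ 𝒜 (d i))
    {S : Finset ι} {m m' : ℕ} (hm : m₀ ≤ m) (hm' : m₀ ≤ m') (hSm : ∀ i ∈ S, d i + m₀ ≤ m)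
    (hSm' : ∀ i ∈ S, d i + m₀ ≤ m') :
    Module.finrank k (gradedSpan 𝒜 g d S m) = Module.finrank k (gradedSpan 𝒜 g d S m') := by
  obtain ⟨D₀, hD₀⟩ := exists_homogeneous_nonzerodivisor 𝒜 hstd
  refine Nat.eq_of_forall_add_eq (h := fun m => Module.finrank k (gradedSpan 𝒜 g d S m))
    (m₀ := m₀ ⊔ S.sup fun i => d i + m₀) (D₀ := D₀) ?_
    (sup_le hm (Finset.sup_le hSm)) (sup_le hm' (Finset.sup_le hSm'))
  intro a ha D hD
  have ham : m₀ ≤ a := le_sup_left.trans ha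
  have hSa : ∀ i ∈ S, d i + m₀ ≤ a := Finset.sup_le_iff.1 (le_sup_right.trans ha)
  obtain ⟨y, hy, hinj⟩ := hD₀ D hD
  have hUle : gradedSpan 𝒜 g d S a ≤ 𝒜 a :=
    gradedSpan_le 𝒜 hg fun i hi => (Nat.le_add_right _ _).trans (hSa i hi)
  have : FiniteDimensional k (gradedSpan 𝒜 g d S a) := Submodule.finiteDimensional_of_le hUle
  have hmap : (gradedSpan 𝒜 g d S a).map (LinearMap.mulLeft k y) = gradedSpan 𝒜 g d S (a + D) := by
    simp only [gradedSpan, Submodule.map_iSup]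
    refine iSup_congr fun i => iSup_congr fun hi => ?_
    have hi' := hSa i hi
    have hdeg : a + D - d i = a - d i + D := by omega
    rw [hdeg, ← map_mulLeft_eq 𝒜 hy (hinj (a - d i) (by omega))
      ((hstab _ (by omega)).trans (hstab _ (by omega)).symm), ← Submodule.map_comp,
      ← Submodule.map_comp]
    congr 1
    ext z
    simp [mul_left_comm]
  rw [← hmap, Submodule.finrank_map_of_forall_eq_zero]
  exact fun v hv => hinj a (hm₀.trans ham) v (hUle hv)

lemma map_mulLeft_pow_eq {k R : Type*} [Field k] [CommRing R] [IsNoetherianRing R]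
    [Algebra k R] [IsReduced R]
    (𝒜 : ℕ → Submodule k R) [GradedAlgebra 𝒜] [∀ m, FiniteDimensional k (𝒜 m)]
    (hstd : ∀ m : ℕ, (𝒜 (m + 1) : Set R) ⊆
      Submodule.span k (Set.image2 (· * ·) (𝒜 1 : Set R) (𝒜 m : Set R)))
    {m₀ : ℕ} (hm₀ : 1 ≤ m₀)
    (hstab : ∀ m, m₀ ≤ m → Module.finrank k (𝒜 m) = Module.finrank k (𝒜 m₀))
    {g : R} {d q m : ℕ} (hg : g ∈ 𝒜 d) (hq : 1 ≤ q) (hm : q * d + m₀ ≤ m) :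
    (𝒜 (m - q * d)).map (LinearMap.mulLeft k (g ^ q)) =
      (𝒜 (m - d)).map (LinearMap.mulLeft k g) := by
  have hdq : d ≤ q * d := Nat.le_mul_of_pos_left d hq
  refine Submodule.eq_of_le_of_finrank_eq ?_ ?_
  · rintro _ ⟨z, hz, rfl⟩
    refine ⟨g ^ (q - 1) * z, ?_, ?_⟩
    · have := SetLike.mul_mem_graded (SetLike.pow_mem_graded (q - 1) hg) hz
      have hdeg : (q - 1) • d + (m - q * d) = m - d := by
        obtain ⟨q, rfl⟩ := Nat.exists_eq_add_of_le' hq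
        simp only [Nat.add_sub_cancel, smul_eq_mul]
        have : (q + 1) * d = q * d + d := by ring
        omega
      rwa [hdeg] at this
    · simp only [LinearMap.mulLeft_apply, ← mul_assoc, ← pow_succ', Nat.sub_add_cancel hq]
  · have hker : (LinearMap.mulLeft k (g ^ q)).ker ⊓ 𝒜 (m - q * d) =
        (LinearMap.mulLeft k g).ker ⊓ 𝒜 (m - q * d) := by
      congr 1
      ext z
      simp only [LinearMap.mem_ker, LinearMap.mulLeft_apply]
      refine ⟨fun h => ?_, fun h => ?_⟩
      · refine eq_zero_of_pow_eq_zero (n := q) ?_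
        obtain ⟨q, rfl⟩ := Nat.exists_eq_add_of_le' hq
        rw [mul_pow, pow_succ z, mul_left_comm, ← mul_assoc, mul_assoc, h, mul_zero]
      · obtain ⟨q, rfl⟩ := Nat.exists_eq_add_of_le' hq
        rw [pow_succ, mul_assoc, h, mul_zero]
    have h1 := Submodule.finrank_map_add_finrank_inf_ker (LinearMap.mulLeft k (g ^ q))
      (𝒜 (m - q * d))
    have h2 := Submodule.finrank_map_add_finrank_inf_ker (LinearMap.mulLeft k g)
      (𝒜 (m - q * d))
    have h3 := finrank_gradedSpan_eq 𝒜 hstd hm₀ hstab (g := fun _ : Unit => g) (d := fun _ => d)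
      (fun _ => hg) (S := Finset.univ) (m := m - q * d + d) (m' := m) (by omega) (by omega)
      (fun _ _ => by omega) (fun _ _ => by omega)
    have h4 : ∀ m, gradedSpan 𝒜 (fun _ : Unit => g) (fun _ => d) Finset.univ m =
        (𝒜 (m - d)).map (LinearMap.mulLeft k g) := fun m => by simp [gradedSpan]
    rw [h4, h4, Nat.add_sub_cancel] at h3
    rw [hker] at h1
    omega

lemma frobeniusPower_span_range {R : Type*} [CommRing R] (p : ℕ) [ExpChar R p] {ι : Type*}
    [Fintype ι] (g : ι → R) (n : ℕ) :
    frobeniusPower (Ideal.span (Set.range g)) (p ^ n) =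
      Ideal.span (Set.range fun i => g i ^ p ^ n) := by
  refine le_antisymm (Ideal.span_le.2 ?_) (Ideal.span_le.2 ?_)
  · rintro _ ⟨x, hx, rfl⟩
    obtain ⟨c, rfl⟩ := Ideal.mem_span_range_iff_exists_fun.1 hx
    simp only [sum_pow_char_pow, mul_pow]
    exact sum_mem fun i _ => Ideal.mul_mem_left _ _ (Ideal.subset_span ⟨i, rfl⟩)
  · rintro _ ⟨i, rfl⟩
    exact Ideal.subset_span ⟨g i, Ideal.subset_span ⟨i, rfl⟩, rfl⟩

lemma ringGradedPieceLength_add_finrank_inf {k R : Type*} [Field k] [CommRing R] [Algebra k R]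
    (𝒜 : ℕ → Submodule k R) [∀ m, FiniteDimensional k (𝒜 m)] (I : Ideal R) (q m : ℕ) :
    ringGradedPieceLength 𝒜 I q m +
      Module.finrank k ((frobeniusPower I q).restrictScalars k ⊓ 𝒜 m : Submodule k R) =
      Module.finrank k (𝒜 m) := by
  have hker : (frobeniusPower I q).restrictScalars k =
      (Ideal.Quotient.mkₐ k (frobeniusPower I q)).toLinearMap.ker := by
    ext x
    simp [Ideal.Quotient.eq_zero_iff_mem]
  rw [← Submodule.finrank_map_add_finrank_inf_ker
    (Ideal.Quotient.mkₐ k (frobeniusPower I q)).toLinearMap (𝒜 m), ringGradedPieceLength, hker]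

/-- Away from the degrees in `[0, m₀)` and `[q * deg i, q * deg i + m₀)`, the length of a graded
piece of `R ⧸ I^{[q]}` depends only on the set of generators that contribute to it. -/
lemma ringGradedPieceLength_add_finrank_gradedSpan {k R : Type*} [Field k] [CommRing R]
    [IsNoetherianRing R] [Algebra k R] [IsReduced R]
    (𝒜 : ℕ → Submodule k R) [GradedAlgebra 𝒜] [∀ m, FiniteDimensional k (𝒜 m)]
    (hstd : ∀ m : ℕ, (𝒜 (m + 1) : Set R) ⊆
      Submodule.span k (Set.image2 (· * ·) (𝒜 1 : Set R) (𝒜 m : Set R)))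
    {m₀ : ℕ} (hm₀ : 1 ≤ m₀)
    (hstab : ∀ m, m₀ ≤ m → Module.finrank k (𝒜 m) = Module.finrank k (𝒜 m₀))
    (p : ℕ) [ExpChar R p] {ι : Type*} [Fintype ι] {gens : ι → R} {deg : ι → ℕ}
    (hdeg : ∀ i, gens i ∈ 𝒜 (deg i)) {S : Finset ι} {n m : ℕ} (hm : m₀ ≤ m)
    (hS : ∀ i, i ∈ S → p ^ n * deg i + m₀ ≤ m) (hS' : ∀ i, i ∉ S → m < p ^ n * deg i) :
    ringGradedPieceLength 𝒜 (Ideal.span (Set.range gens)) (p ^ n) m +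
      Module.finrank k (gradedSpan 𝒜 gens deg S (m₀ + ∑ i, deg i)) =
      Module.finrank k (𝒜 m₀) := by
  classical
  have hq : 1 ≤ p ^ n := Nat.one_le_pow _ _ (expChar_pos R p)
  rw [← hstab m hm, ← ringGradedPieceLength_add_finrank_inf 𝒜 (Ideal.span (Set.range gens)) (p ^ n),
    frobeniusPower_span_range,
    span_range_inf_eq_gradedSpan 𝒜 (g := fun i => gens i ^ p ^ n) (d := fun i => p ^ n * deg i)
      (fun i => SetLike.pow_mem_graded (p ^ n) (hdeg i))]
  have hfilter : (Finset.univ.filter fun i => p ^ n * deg i ≤ m) = S := by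
    ext i
    simp only [Finset.mem_filter, Finset.mem_univ, true_and]
    refine ⟨fun h => ?_, fun h => (Nat.le_add_right _ _).trans (hS i h)⟩
    by_contra hi
    exact (hS' i hi).not_ge h
  have hspan : gradedSpan 𝒜 (fun i => gens i ^ p ^ n) (fun i => p ^ n * deg i) S m =
      gradedSpan 𝒜 gens deg S m :=
    iSup_congr fun i => iSup_congr fun hi =>
      map_mulLeft_pow_eq 𝒜 hstd hm₀ hstab (hdeg i) hq (hS i hi)
  rw [hfilter, hspan, finrank_gradedSpan_eq 𝒜 hstd hm₀ hstab hdeg (Nat.le_add_right _ _) hm]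
  · intro i _
    have := Finset.single_le_sum (f := deg) (fun _ _ => Nat.zero_le _) (Finset.mem_univ i)
    omega
  · intro i hi
    have := Nat.le_mul_of_pos_left (deg i) hq
    have := hS i hi
    omega

/-! ### Finite colength -/

lemma span_degree_one_le_radical {k R : Type*} [Field k] [CommRing R] [Algebra k R]
    (𝒜 : ℕ → Submodule k R) [GradedAlgebra 𝒜] (I : Ideal R) (hI : I.IsHomogeneous 𝒜)
    [Module.Finite k (R ⧸ I)] : Ideal.span (𝒜 1 : Set R) ≤ I.radical := by
  classical
  refine Ideal.span_le.2 fun x hx => ?_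
  obtain ⟨f, hf, hfx⟩ := IsIntegral.of_finite k (Ideal.Quotient.mk I x)
  have hmem : Polynomial.aeval x f ∈ I := by
    rw [← Ideal.Quotient.eq_zero_iff_mem, ← Ideal.Quotient.mkₐ_eq_mk k,
      ← Polynomial.aeval_algHom_apply]
    exact hfx
  have hpow : ∀ i, x ^ i ∈ 𝒜 i := fun i => by simpa using SetLike.pow_mem_graded i hx
  have hcomp := hI f.natDegree hmem
  rw [Polynomial.aeval_eq_sum_range, DirectSum.decompose_sum, DFinsupp.finsetSum_apply,
    AddSubmonoidClass.coe_finsetSum, Finset.sum_eq_single f.natDegree,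
    DirectSum.decompose_of_mem_same 𝒜 ((𝒜 _).smul_mem _ (hpow _)), hf.coeff_natDegree,
    one_smul] at hcomp
  · exact ⟨_, hcomp⟩
  · exact fun i _ hi => DirectSum.decompose_of_mem_ne 𝒜 ((𝒜 _).smul_mem _ (hpow _)) hi
  · exact fun h => absurd (Finset.self_mem_range_succ _) h

lemma exists_forall_le_frobeniusPower {k R : Type*} [Field k] [CommRing R] [IsNoetherianRing R]
    [Algebra k R] (𝒜 : ℕ → Submodule k R) [GradedAlgebra 𝒜]
    (hstd : ∀ m : ℕ, (𝒜 (m + 1) : Set R) ⊆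
      Submodule.span k (Set.image2 (· * ·) (𝒜 1 : Set R) (𝒜 m : Set R)))
    (I : Ideal R) (hI : I.IsHomogeneous 𝒜) [Module.Finite k (R ⧸ I)] (q : ℕ) :
    ∃ N, ∀ m, N ≤ m → 𝒜 m ≤ (frobeniusPower I q).restrictScalars k := by
  have hrad : I.radical ≤ (frobeniusPower I q).radical :=
    Ideal.radical_le_radical_iff.2 fun x hx => ⟨q, Ideal.subset_span ⟨x, hx, rfl⟩⟩
  obtain ⟨N, hN⟩ := Ideal.exists_pow_le_of_le_radical_of_fg
    ((span_degree_one_le_radical 𝒜 I hI).trans hrad) (IsNoetherian.noetherian _)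
  exact ⟨N, fun m hm x hx =>
    hN (Ideal.pow_le_pow_right hm (mem_of_degree_one_le 𝒜 hstd m hx))⟩

lemma finrank_quotient_eq_sum {k R : Type*} [Field k] [CommRing R] [Algebra k R]
    (𝒜 : ℕ → Submodule k R) [GradedAlgebra 𝒜] [∀ m, FiniteDimensional k (𝒜 m)]
    (J : Ideal R) (hJ : J.IsHomogeneous 𝒜) {N : ℕ}
    (hN : ∀ m, N ≤ m → 𝒜 m ≤ J.restrictScalars k) :
    Module.finrank k (R ⧸ J) = ∑ m ∈ Finset.range N,
      Module.finrank k ((𝒜 m).map (Ideal.Quotient.mkₐ k J).toLinearMap) := by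
  classical
  let π := (Ideal.Quotient.mkₐ k J).toLinearMap
  let φ : R →ₗ[k] (∀ i : Fin N, ((𝒜 i).map π : Submodule k (R ⧸ J))) :=
    LinearMap.pi fun i => LinearMap.codRestrict _ (π ∘ₗ GradedAlgebra.proj 𝒜 i)
      fun x => ⟨_, SetLike.coe_mem _, rfl⟩
  have hφ : ∀ x i, (φ x i : R ⧸ J) = Ideal.Quotient.mk J (DirectSum.decompose 𝒜 x i) :=
    fun _ _ => rfl
  have hsurj : Function.Surjective φ := by
    intro w
    choose a ha haw using fun i => (w i).2
    refine ⟨∑ i, a i, funext fun i => Subtype.ext ?_⟩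
    rw [hφ, DirectSum.decompose_sum, DFinsupp.finsetSum_apply, AddSubmonoidClass.coe_finsetSum,
      Finset.sum_eq_single i, DirectSum.decompose_of_mem_same 𝒜 (ha i)]
    · exact haw i
    · exact fun j _ hj => DirectSum.decompose_of_mem_ne 𝒜 (ha j) fun h => hj (Fin.ext h)
    · exact fun h => absurd (Finset.mem_univ _) h
  have hker : φ.ker = J.restrictScalars k := by
    ext x
    simp only [LinearMap.mem_ker, Submodule.restrictScalars_mem]
    refine ⟨fun h => ?_, fun h => funext fun i => Subtype.ext ?_⟩
    · rw [← DirectSum.sum_support_decompose 𝒜 x]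
      refine J.sum_mem fun i _ => ?_
      by_cases hi : i < N
      · rw [← Ideal.Quotient.eq_zero_iff_mem, ← hφ x ⟨i, hi⟩, h]
        rfl
      · exact hN i (not_lt.1 hi) (SetLike.coe_mem _)
    · rw [hφ, Ideal.Quotient.eq_zero_iff_mem.2 (hJ i h)]
      rfl
  rw [← (Submodule.Quotient.restrictScalarsEquiv k J).finrank_eq, ← hker,
    (φ.quotKerEquivOfSurjective hsurj).finrank_eq, Module.finrank_pi_fintype,
    Finset.sum_range]

/-! ### Integrals of step functions -/

lemma stepFunction_eq_sum_indicator (c : ℕ → ℕ) {N : ℕ} (hc : ∀ m, N ≤ m → c m = 0) {q : ℝ}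
    (hq : 0 < q) :
    (fun x : ℝ => if x < 0 then 0 else (c ⌊x * q⌋₊ : ℝ)) = fun x => ∑ m ∈ Finset.range N,
      (Set.Ico ((m : ℝ) / q) ((m + 1 : ℝ) / q)).indicator (fun _ => (c m : ℝ)) x := by
  funext x
  have hmem : ∀ m : ℕ, x ∈ Set.Ico ((m : ℝ) / q) ((m + 1 : ℝ) / q) ↔
      0 ≤ x ∧ ⌊x * q⌋₊ = m := by
    intro m
    rw [Set.mem_Ico, div_le_iff₀ hq, lt_div_iff₀ hq]
    refine ⟨fun h => ?_, fun h => (Nat.floor_eq_iff (mul_nonneg h.1 hq.le)).1 h.2⟩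
    have h0 : 0 ≤ x * q := (Nat.cast_nonneg m).trans h.1
    exact ⟨nonneg_of_mul_nonneg_left h0 hq, (Nat.floor_eq_iff h0).2 h⟩
  simp only [Set.indicator_apply, hmem]
  split_ifs with hx
  · simp [not_le.2 hx]
  · simp only [not_lt.1 hx, true_and, Finset.sum_ite_eq, Finset.mem_range]
    split_ifs with h
    · rfl
    · rw [hc _ (not_lt.1 h), Nat.cast_zero]

lemma integrable_stepFunction (c : ℕ → ℕ) {N : ℕ} (hc : ∀ m, N ≤ m → c m = 0) {q : ℝ}
    (hq : 0 < q) : Integrable fun x : ℝ => if x < 0 then 0 else (c ⌊x * q⌋₊ : ℝ) := by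
  rw [stepFunction_eq_sum_indicator c hc hq]
  exact integrable_finsetSum _ fun m _ => (integrable_indicator_iff measurableSet_Ico).2
    (integrableOn_const (by simp))

lemma integral_stepFunction (c : ℕ → ℕ) {N : ℕ} (hc : ∀ m, N ≤ m → c m = 0) {q : ℝ}
    (hq : 0 < q) : ∫ x : ℝ, (if x < 0 then 0 else (c ⌊x * q⌋₊ : ℝ)) =
      ((∑ m ∈ Finset.range N, c m : ℕ) : ℝ) / q := by
  rw [stepFunction_eq_sum_indicator c hc hq, integral_finsetSum _ fun m _ =>
    (integrable_indicator_iff measurableSet_Ico).2 (integrableOn_const (by simp))]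
  push_cast
  rw [Finset.sum_div]
  refine Finset.sum_congr rfl fun m _ => ?_
  rw [integral_indicator_const _ measurableSet_Ico, Real.volume_real_Ico_of_le (by gcongr; simp),
    smul_eq_mul]
  ring

lemma abs_integral_sub_integral_le {f g : ℝ → ℝ} (hf : Integrable f) (hg : Integrable g)
    {T : Set ℝ} (hT : volume T < ⊤) (hfg : ∀ x, x ∉ T → f x = g x) {C : ℝ}
    (hf0 : ∀ x, 0 ≤ f x) (hfC : ∀ x, f x ≤ C) (hg0 : ∀ x, 0 ≤ g x) (hgC : ∀ x, g x ≤ C) :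
    |(∫ x, f x) - ∫ x, g x| ≤ C * volume.real T := by
  rw [← integral_sub hf hg, ← setIntegral_eq_integral_of_forall_compl_eq_zero
    (s := T) fun x hx => sub_eq_zero.2 (hfg x hx), ← Real.norm_eq_abs]
  refine norm_setIntegral_le_of_norm_le_const hT fun x _ => ?_
  rw [Real.norm_eq_abs, abs_sub_le_iff]
  constructor <;> linarith [hf0 x, hfC x, hg0 x, hgC x]

/-- The set outside of which `fDimOne` with parameter `q` agrees with its limit. -/
def exceptionalSet {ι : Type*} (deg : ι → ℕ) (m₀ : ℕ) (q : ℝ) : Set ℝ :=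
  Set.Ico 0 (m₀ / q) ∪ ⋃ i, Set.Ico (deg i : ℝ) (deg i + m₀ / q)

lemma exceptionalSet_anti {ι : Type*} (deg : ι → ℕ) (m₀ : ℕ) {q q' : ℝ} (hq : 0 < q)
    (hqq' : q ≤ q') : exceptionalSet deg m₀ q' ⊆ exceptionalSet deg m₀ q := by
  have : (m₀ : ℝ) / q' ≤ m₀ / q := by gcongr
  exact Set.union_subset_union (Set.Ico_subset_Ico_right this)
    (Set.iUnion_mono fun i => Set.Ico_subset_Ico_right (by gcongr))

lemma measurableSet_exceptionalSet {ι : Type*} [Countable ι] (deg : ι → ℕ) (m₀ : ℕ) (q : ℝ) :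
    MeasurableSet (exceptionalSet deg m₀ q) :=
  measurableSet_Ico.union (MeasurableSet.iUnion fun _ => measurableSet_Ico)

lemma volume_exceptionalSet_lt_top {ι : Type*} [Finite ι] (deg : ι → ℕ) (m₀ : ℕ) (q : ℝ) :
    volume (exceptionalSet deg m₀ q) < ⊤ :=
  ((Metric.isBounded_Ico _ _).union
    (Bornology.isBounded_iUnion.2 fun _ => Metric.isBounded_Ico _ _)).measure_lt_top

lemma volume_real_exceptionalSet_le {ι : Type*} [Fintype ι] (deg : ι → ℕ) (m₀ : ℕ) {q : ℝ}
    (hq : 0 < q) :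
    volume.real (exceptionalSet deg m₀ q) ≤ (Fintype.card ι + 1) * (m₀ / q) := by
  have h0 : (0 : ℝ) ≤ m₀ / q := by positivity
  refine (measureReal_union_le _ _).trans ?_
  have h1 : volume.real (Set.Ico (0 : ℝ) (m₀ / q)) = m₀ / q := by
    rw [Real.volume_real_Ico_of_le h0, sub_zero]
  have h2 : volume.real (⋃ i, Set.Ico (deg i : ℝ) (deg i + m₀ / q)) ≤
      Fintype.card ι * (m₀ / q) := by
    refine (measureReal_iUnion_fintype_le _).trans (le_of_eq ?_)
    simp only [Real.volume_real_Ico_of_le (le_add_of_nonneg_right h0), add_sub_cancel_left,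
      Finset.sum_const, Finset.card_univ, nsmul_eq_mul]
  linarith

lemma fDimOne_eq_of_notMem_exceptionalSet {k R : Type*} [Field k] [CommRing R]
    [IsNoetherianRing R] [Algebra k R] [IsReduced R]
    (𝒜 : ℕ → Submodule k R) [GradedAlgebra 𝒜] [∀ m, FiniteDimensional k (𝒜 m)]
    (hstd : ∀ m : ℕ, (𝒜 (m + 1) : Set R) ⊆
      Submodule.span k (Set.image2 (· * ·) (𝒜 1 : Set R) (𝒜 m : Set R)))
    {m₀ : ℕ} (hm₀ : 1 ≤ m₀)
    (hstab : ∀ m, m₀ ≤ m → Module.finrank k (𝒜 m) = Module.finrank k (𝒜 m₀))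
    (p : ℕ) [ExpChar R p] {ι : Type*} [Fintype ι] {gens : ι → R} {deg : ι → ℕ}
    (hdeg : ∀ i, gens i ∈ 𝒜 (deg i)) {n n' : ℕ} (hn : n ≤ n') {x : ℝ}
    (hx : x ∉ exceptionalSet deg m₀ ((p : ℝ) ^ n)) :
    fDimOne 𝒜 (Ideal.span (Set.range gens)) p n' x =
      fDimOne 𝒜 (Ideal.span (Set.range gens)) p n x := by
  classical
  unfold fDimOne
  split_ifs with hx0
  · rfl
  have hx0 := not_lt.1 hx0
  have hp1 : (1 : ℝ) ≤ p := Nat.one_le_cast.2 (expChar_pos R p)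
  have key : ∀ l, n ≤ l →
      ringGradedPieceLength 𝒜 (Ideal.span (Set.range gens)) (p ^ l) ⌊x * (p : ℝ) ^ l⌋₊ +
        Module.finrank k (gradedSpan 𝒜 gens deg (Finset.univ.filter fun i => (deg i : ℝ) ≤ x)
          (m₀ + ∑ i, deg i)) = Module.finrank k (𝒜 m₀) := by
    intro l hl
    have hql : (0 : ℝ) < (p : ℝ) ^ l := by positivity
    have hxl : x ∉ exceptionalSet deg m₀ ((p : ℝ) ^ l) := fun h =>
      hx (exceptionalSet_anti deg m₀ (by positivity) (pow_le_pow_right₀ hp1 hl) h)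
    simp only [exceptionalSet, Set.mem_union, Set.mem_iUnion, Set.mem_Ico, not_or, not_exists,
      not_and, not_lt] at hxl
    refine ringGradedPieceLength_add_finrank_gradedSpan 𝒜 hstd hm₀ hstab p hdeg ?_ ?_ ?_
    · exact Nat.le_floor ((div_le_iff₀ hql).1 (hxl.1 hx0))
    · intro i hi
      have h := mul_le_mul_of_nonneg_right (hxl.2 i (Finset.mem_filter.1 hi).2) hql.le
      rw [add_mul, div_mul_cancel₀ _ hql.ne'] at h
      refine Nat.le_floor ?_
      push_cast
      linarith
    · intro i hi
      have hi : x < deg i := by simpa using hi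
      rw [Nat.floor_lt (by positivity)]
      push_cast
      rw [mul_comm]
      exact mul_lt_mul_of_pos_left hi hql
  rw [Nat.add_right_cancel ((key n' hn).trans (key n le_rfl).symm)]

/-- In dimension one, `e_HK(R, I) = ∫_ℝ f`, where `f = lim_n f_n` pointwise; moreover
`|∫ f_n − ∫ f| ≤ L·(μ+1)·m_0/p^n` with `L = max{ℓ(R_0), …, ℓ(R_{m_0})}`. -/
theorem stmt6
    (k : Type*) [Field k] (p : ℕ) (hp : p.Prime) [CharP k p] [ExpChar k p] [PerfectRing k p]
    (R : Type*) [CommRing R] [IsNoetherianRing R] [Algebra k R] [IsReduced R]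
    (𝒜 : ℕ → Submodule k R) [GradedAlgebra 𝒜]
    [∀ m, FiniteDimensional k (𝒜 m)]
    (hstd : ∀ m : ℕ, (𝒜 (m + 1) : Set R) ⊆
      Submodule.span k (Set.image2 (· * ·) (𝒜 1 : Set R) (𝒜 m : Set R)))
    (hdim : ringKrullDim R = 1)
    (I : Ideal R) [Module.Finite k (R ⧸ I)]
    (μ : ℕ) (gens : Fin μ → R) (deg : Fin μ → ℕ)
    (hdeg : ∀ i, gens i ∈ 𝒜 (deg i)) (hdegpos : ∀ i, 0 < deg i)
    (hmono : Monotone deg)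
    (hgen : I = Ideal.span (Set.range gens))
    (m0 : ℕ) (hm0 : 1 ≤ m0)
    (hstab : ∀ m, m0 ≤ m → Module.finrank k (𝒜 m) = Module.finrank k (𝒜 (m + 1)))
    -- the pointwise limit `f` of the `f_n`
    (f : ℝ → ℝ)
    (hf : ∀ x : ℝ, Tendsto (fun n : ℕ => fDimOne 𝒜 I p n x) atTop (nhds (f x))) :
    Tendsto (fun n : ℕ =>
        (Module.finrank k (R ⧸ frobeniusPower I (p ^ n)) : ℝ) / (p : ℝ) ^ n)
      atTop (nhds (∫ x : ℝ, f x)) ∧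
    ∀ n : ℕ, |(∫ x : ℝ, fDimOne 𝒜 I p n x) - ∫ x : ℝ, f x| ≤
      (((Finset.range (m0 + 1)).sup fun m => Module.finrank k (𝒜 m) : ℕ) : ℝ) *
        ((μ : ℝ) + 1) * (m0 : ℝ) / (p : ℝ) ^ n := by
  have : Nontrivial R := by
    by_contra h
    rw [not_nontrivial_iff_subsingleton] at h
    rw [ringKrullDim_eq_bot_of_subsingleton] at hdim
    exact absurd hdim (by decide)
  have : ExpChar R p := expChar_of_injective_algebraMap (algebraMap k R).injective p
  have hp0 : (0 : ℝ) < p := Nat.cast_pos.2 hp.pos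
  have hqpos : ∀ n : ℕ, (0 : ℝ) < (p : ℝ) ^ n := fun n => pow_pos hp0 n
  have hstab' : ∀ m, m0 ≤ m → Module.finrank k (𝒜 m) = Module.finrank k (𝒜 m0) := by
    intro m hm
    induction m, hm using Nat.le_induction with
    | base => rfl
    | succ m hm ih => rw [← hstab m hm, ih]
  set L : ℕ := (Finset.range (m0 + 1)).sup fun m => Module.finrank k (𝒜 m) with hL
  have hrankL : ∀ m, Module.finrank k (𝒜 m) ≤ L := by
    intro m
    rcases le_total m m0 with h | h
    · exact Finset.le_sup (f := fun m => Module.finrank k (𝒜 m)) (by simpa using by omega)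
    · rw [hstab' m h]
      exact Finset.le_sup (f := fun m => Module.finrank k (𝒜 m)) (by simp)
  have hI : I.IsHomogeneous 𝒜 := by
    rw [hgen]
    refine Ideal.homogeneous_span 𝒜 _ ?_
    rintro _ ⟨i, rfl⟩
    exact ⟨_, hdeg i⟩
  have hIn : ∀ n, (frobeniusPower I (p ^ n)).IsHomogeneous 𝒜 := by
    intro n
    rw [hgen, frobeniusPower_span_range]
    refine Ideal.homogeneous_span 𝒜 _ ?_
    rintro _ ⟨i, rfl⟩
    exact ⟨_, SetLike.pow_mem_graded _ (hdeg i)⟩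
  choose N hN using fun n => exists_forall_le_frobeniusPower 𝒜 hstd I hI (p ^ n)
  have hzero : ∀ n m, N n ≤ m → ringGradedPieceLength 𝒜 I (p ^ n) m = 0 := by
    intro n m hm
    have hbot : (𝒜 m).map (Ideal.Quotient.mkₐ k (frobeniusPower I (p ^ n))).toLinearMap = ⊥ := by
      rw [Submodule.eq_bot_iff]
      rintro _ ⟨x, hx, rfl⟩
      exact Ideal.Quotient.eq_zero_iff_mem.2 (hN n m hm hx)
    rw [ringGradedPieceLength, hbot, finrank_bot]
  have hfn_int : ∀ n, Integrable (fDimOne 𝒜 I p n) := fun n =>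
    integrable_stepFunction _ (hzero n) (hqpos n)
  have hintegral : ∀ n, ∫ x, fDimOne 𝒜 I p n x =
      (Module.finrank k (R ⧸ frobeniusPower I (p ^ n)) : ℝ) / (p : ℝ) ^ n := by
    intro n
    rw [finrank_quotient_eq_sum 𝒜 _ (hIn n) (hN n)]
    exact integral_stepFunction _ (hzero n) (hqpos n)
  have hnonneg : ∀ n x, 0 ≤ fDimOne 𝒜 I p n x := by
    intro n x
    unfold fDimOne
    split_ifs <;> positivity
  have hle : ∀ n x, fDimOne 𝒜 I p n x ≤ L := by
    intro n x
    unfold fDimOne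
    split_ifs
    · positivity
    · exact Nat.cast_le.2 ((Submodule.finrank_map_le _ _).trans (hrankL _))
  have hf0 : ∀ x, 0 ≤ f x := fun x => ge_of_tendsto' (hf x) fun n => hnonneg n x
  have hfL : ∀ x, f x ≤ L := fun x => le_of_tendsto' (hf x) fun n => hle n x
  have heq : ∀ n x, x ∉ exceptionalSet deg m0 ((p : ℝ) ^ n) → fDimOne 𝒜 I p n x = f x := by
    intro n x hx
    refine tendsto_nhds_unique (tendsto_const_nhds.congr' ?_) (hf x)
    filter_upwards [eventually_ge_atTop n] with n' hn'
    subst hgen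
    exact (fDimOne_eq_of_notMem_exceptionalSet 𝒜 hstd hm0 hstab' p hdeg hn' hx).symm
  have hfint : Integrable f := by
    set T := exceptionalSet deg m0 ((p : ℝ) ^ 0)
    have hTind : Integrable (T.indicator fun _ => (L : ℝ)) :=
      (integrable_indicator_iff (measurableSet_exceptionalSet _ _ _)).2
        (integrableOn_const (volume_exceptionalSet_lt_top _ _ _).ne)
    refine ((hfn_int 0).add hTind).mono' (aestronglyMeasurable_of_tendsto_ae atTop
      (fun n => (hfn_int n).aestronglyMeasurable) (ae_of_all _ hf)) (ae_of_all _ fun x => ?_)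
    rw [Real.norm_of_nonneg (hf0 x), Pi.add_apply]
    by_cases hx : x ∈ T
    · rw [Set.indicator_of_mem hx]
      linarith [hfL x, hnonneg 0 x]
    · rw [Set.indicator_of_notMem hx, add_zero, heq 0 x hx]
  have hbound : ∀ n : ℕ, |(∫ x : ℝ, fDimOne 𝒜 I p n x) - ∫ x : ℝ, f x| ≤
      (L : ℝ) * ((μ : ℝ) + 1) * (m0 : ℝ) / (p : ℝ) ^ n := by
    intro n
    refine (abs_integral_sub_integral_le (hfn_int n) hfint (volume_exceptionalSet_lt_top _ _ _)
      (heq n) (hnonneg n) (hle n) hf0 hfL).trans ?_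
    have hvol := volume_real_exceptionalSet_le deg m0 (hqpos n)
    rw [Fintype.card_fin] at hvol
    refine (mul_le_mul_of_nonneg_left hvol (Nat.cast_nonneg L)).trans (le_of_eq ?_)
    ring
  refine ⟨?_, hbound⟩
  simp only [← hintegral]
  rw [tendsto_iff_dist_tendsto_zero]
  refine squeeze_zero (fun _ => dist_nonneg) hbound ?_
  exact tendsto_const_nhds.div_atTop
    (tendsto_pow_atTop_atTop_of_one_lt (Nat.one_lt_cast.2 hp.one_lt))
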